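/- Let S and T be finite nonempty types and let p be a joint probability mass function on S × T with marginals p_X and p_Y. Then the conditional entropy is at most the entropy: H(X|Y) ≤ H(X), with equality if and only if p(x,y) = p_X(x) · p_Y(y) for all x ∈ S and y ∈ T (i.e., X and Y are independent). -/

import Mathlib

open Real Finset

/-- Pointwise Gibbs inequality with its equality case. -/
theorem gibbs_point (p u v : ℝ) (hp : 0 ≤ p) (hu : p ≤ u) (hv : p ≤ v) :
    0 ≤ p * Real.log (p / v) - p * Real.log u - p + u * v ∧
      (p * Real.log (p / v) - p * Real.log u - p + u * v = 0 ↔ p = u * v) := by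
  rcases hp.eq_or_lt with h | h
  · subst h
    have := mul_nonneg hu hv
    simp only [zero_mul, sub_zero, zero_add]
    exact ⟨this, eq_comm⟩
  · have hu' : 0 < u := h.trans_le hu
    have hv' : 0 < v := h.trans_le hv
    have ht : 0 < u * v / p := by positivity
    have hlog : Real.log (u * v / p) = Real.log u - Real.log (p / v) := by
      rw [Real.log_div (by positivity) h.ne', Real.log_mul hu'.ne' hv'.ne',
        Real.log_div h.ne' hv'.ne']
      ring
    have key : p * Real.log (p / v) - p * Real.log u - p + u * v
        = p * (u * v / p - 1 - Real.log (u * v / p)) := by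
      rw [hlog]
      field_simp
      ring
    rw [key]
    refine ⟨mul_nonneg hp (sub_nonneg.2 (Real.log_le_sub_one_of_pos ht)), ?_, ?_⟩
    · intro h0
      by_contra hne
      have h1 : u * v / p ≠ 1 := by
        intro h1
        rw [div_eq_one_iff_eq h.ne'] at h1
        exact hne h1.symm
      have := mul_pos h (sub_pos.2 (Real.log_lt_sub_one_of_pos ht h1))
      linarith
    · intro h0
      rw [← h0, div_self h.ne']
      simp

/-- Conditioning reduces entropy: `H(X|Y) ≤ H(X)`, with equality iff `X` and `Y` are
independent. -/
theorem condEntropy_le_entropy_iff_indep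
    {S T : Type*} [Fintype S] [Nonempty S] [Fintype T] [Nonempty T]
    (p : S × T → ℝ) (hp : ∀ a, 0 ≤ p a) (hsum : ∑ a, p a = 1)
    (pX : S → ℝ) (pY : T → ℝ)
    (hpX : ∀ x, pX x = ∑ y, p (x, y)) (hpY : ∀ y, pY y = ∑ x, p (x, y)) :
    (-(∑ a, p a * Real.log (p a / pY a.2))) ≤ (-(∑ x, pX x * Real.log (pX x))) ∧
      ((-(∑ a, p a * Real.log (p a / pY a.2))) = (-(∑ x, pX x * Real.log (pX x))) ↔
        ∀ x y, p (x, y) = pX x * pY y) := by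
  have hX : ∑ x, pX x = 1 := by
    simp only [hpX]
    rw [← hsum, Fintype.sum_prod_type]
  have hY : ∑ y, pY y = 1 := by
    simp only [hpY]
    rw [← hsum, Fintype.sum_prod_type_right]
  have hXle : ∀ a : S × T, p a ≤ pX a.1 := fun a => by
    rw [hpX]
    exact Finset.single_le_sum (f := fun y => p (a.1, y)) (fun y _ => hp _) (Finset.mem_univ a.2)
  have hYle : ∀ a : S × T, p a ≤ pY a.2 := fun a => by
    rw [hpY]
    exact Finset.single_le_sum (f := fun x => p (x, a.2)) (fun x _ => hp _) (Finset.mem_univ a.1)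
  have hlogX : ∑ a : S × T, p a * Real.log (pX a.1) = ∑ x, pX x * Real.log (pX x) := by
    rw [Fintype.sum_prod_type]
    refine Finset.sum_congr rfl fun x _ => ?_
    dsimp only
    rw [← Finset.sum_mul, ← hpX]
  have hprod : ∑ a : S × T, pX a.1 * pY a.2 = 1 := by
    rw [Fintype.sum_prod_type]
    simp only [← Finset.mul_sum, hY, mul_one, hX]
  have key : ∑ a : S × T, (p a * Real.log (p a / pY a.2) - p a * Real.log (pX a.1) - p a
      + pX a.1 * pY a.2)
      = ∑ a, p a * Real.log (p a / pY a.2) - ∑ x, pX x * Real.log (pX x) := by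
    rw [Finset.sum_add_distrib, Finset.sum_sub_distrib, Finset.sum_sub_distrib, hlogX, hprod, hsum]
    ring
  have hg := fun a : S × T => gibbs_point (p a) (pX a.1) (pY a.2) (hp a) (hXle a) (hYle a)
  have hnn := Finset.sum_nonneg (s := Finset.univ) fun a _ => (hg a).1
  have hz := Finset.sum_eq_zero_iff_of_nonneg (s := Finset.univ) fun a _ => (hg a).1
  rw [key] at hnn hz
  refine ⟨by linarith, ?_, ?_⟩
  · intro h x y
    exact (hg (x, y)).2.1 (hz.1 (by linarith) (x, y) (Finset.mem_univ _))
  · intro h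
    have := hz.2 fun a _ => (hg a).2.2 (h a.1 a.2)
    linarith
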